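/- arXiv:1501.01265 — 2 statements merged into one kernel-verified Lean document; each statement's English description precedes it below -/
import Mathlib

section
/- Let T ≥ 2 and S ≥ 1 be integers with S(T−1) > 2, and let σ > 0. Let U and V be independent random variables, with U distributed as χ²_{T−1} and V distributed as χ²_{S(T−1)}. Then E[σ² · S · U / V] = σ² S(T−1) / (S(T−1) − 2). In particular, the SMD estimator σ̂²_SMD = σ² S U/V has expectation σ² S(T−1)/(S(T−1)−2) and bias 2σ²/(S(T−1)−2). -/
open MeasureTheory ProbabilityTheory Real

/-- The chi-square distribution with `d` degrees of freedom: the measure on `ℝ` with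
density `x ↦ x^{d/2-1} e^{-x/2} / (2^{d/2} Γ(d/2))` on `(0, ∞)` and zero elsewhere. -/
noncomputable def chiSquareMeasure (d : ℝ) : Measure ℝ :=
  volume.withDensity fun x =>
    ENNReal.ofReal
      (if 0 < x then x ^ (d / 2 - 1) * Real.exp (-x / 2) /
          (2 ^ (d / 2) * Real.Gamma (d / 2)) else 0)

/-- The real moments of the chi-square distribution. -/
theorem integral_rpow_chiSquareMeasure {d p : ℝ} (hd : 0 < d) (hp : 0 < d / 2 + p) :
    ∫ x, x ^ p ∂chiSquareMeasure d = 2 ^ p * Gamma (d / 2 + p) / Gamma (d / 2) := by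
  have hΓ : 0 < Gamma (d / 2) := Gamma_pos_of_pos (by positivity)
  have hmeas : Measurable fun x : ℝ ↦
      if 0 < x then x ^ (d / 2 - 1) * Real.exp (-x / 2) / (2 ^ (d / 2) * Real.Gamma (d / 2))
      else 0 :=
    Measurable.ite measurableSet_Ioi (by fun_prop) measurable_const
  rw [chiSquareMeasure, integral_withDensity_eq_integral_toReal_smul hmeas.ennreal_ofReal
    (ae_of_all _ fun _ ↦ ENNReal.ofReal_lt_top)]
  have hdensity (x : ℝ) :
      (ENNReal.ofReal (if 0 < x then x ^ (d / 2 - 1) * Real.exp (-x / 2) /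
        (2 ^ (d / 2) * Real.Gamma (d / 2)) else 0)).toReal • x ^ p =
      (Set.Ioi 0).indicator (fun x ↦ (2 ^ (d / 2) * Gamma (d / 2))⁻¹ *
        (x ^ (d / 2 + p - 1) * exp (-(1 / 2 * x)))) x := by
    by_cases hx : 0 < x
    · rw [if_pos hx, Set.indicator_of_mem (Set.mem_Ioi.2 hx),
        ENNReal.toReal_ofReal (by positivity), smul_eq_mul,
        show d / 2 + p - 1 = d / 2 - 1 + p by ring, rpow_add hx,
        show -(1 / 2 * x) = -x / 2 by ring]
      ring
    · simp [hx]
  simp_rw [hdensity]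
  rw [integral_indicator measurableSet_Ioi, integral_const_mul,
    integral_rpow_mul_exp_neg_mul_Ioi hp (by norm_num), one_div_one_div,
    rpow_add two_pos]
  field_simp

theorem integral_id_chiSquareMeasure {d : ℝ} (hd : 0 < d) :
    ∫ x, x ∂chiSquareMeasure d = d := by
  have h := integral_rpow_chiSquareMeasure (p := 1) hd (by positivity)
  have hΓ : 0 < Gamma (d / 2) := Gamma_pos_of_pos (by positivity)
  simp only [rpow_one] at h
  rw [h, Gamma_add_one (by positivity)]
  field_simp

theorem integral_inv_chiSquareMeasure {d : ℝ} (hd : 2 < d) :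
    ∫ x, x⁻¹ ∂chiSquareMeasure d = (d - 2)⁻¹ := by
  have h := integral_rpow_chiSquareMeasure (d := d) (p := -1) (by linarith) (by linarith)
  have hpos : 0 < d / 2 + -1 := by linarith
  have hΓ : 0 < Gamma (d / 2 + -1) := Gamma_pos_of_pos hpos
  have hrec := Gamma_add_one hpos.ne'
  rw [neg_add_cancel_right] at hrec
  simp only [rpow_neg_one] at h
  rw [h, hrec, mul_div_mul_right _ _ hΓ.ne', show d / 2 + -1 = (d - 2) / 2 by ring]
  field_simp

/-- In the Gaussian example, the SMD variance estimator `σ̂²_SMD = σ² S U / V`, with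
independent `U ~ χ²_{T-1}` and `V ~ χ²_{S(T-1)}`, has expectation
`σ² S(T-1)/(S(T-1)-2)` and hence bias `2σ²/(S(T-1)-2)`. -/
theorem smd_estimator_mean (T S : ℕ) (hT : 2 ≤ T) (hS : 1 ≤ S)
    (h : 2 < (S : ℝ) * ((T : ℝ) - 1)) (σ : ℝ) (hσ : 0 < σ)
    {Ω : Type*} [MeasurableSpace Ω] (P : Measure Ω) [IsProbabilityMeasure P]
    (U V : Ω → ℝ) (hUmeas : Measurable U) (hVmeas : Measurable V)
    (hUV : IndepFun U V P)
    (hU : Measure.map U P = chiSquareMeasure ((T : ℝ) - 1))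
    (hV : Measure.map V P = chiSquareMeasure ((S : ℝ) * ((T : ℝ) - 1))) :
    (∫ ω, σ ^ 2 * (S : ℝ) * U ω / V ω ∂P) =
        σ ^ 2 * ((S : ℝ) * ((T : ℝ) - 1)) / ((S : ℝ) * ((T : ℝ) - 1) - 2) ∧
    (∫ ω, σ ^ 2 * (S : ℝ) * U ω / V ω ∂P) - σ ^ 2 =
        2 * σ ^ 2 / ((S : ℝ) * ((T : ℝ) - 1) - 2) := by
  have hT1 : (0 : ℝ) < (T : ℝ) - 1 := by
    have : (2 : ℝ) ≤ T := by exact_mod_cast hT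
    linarith
  have hEU : ∫ ω, U ω ∂P = (T : ℝ) - 1 := by
    rw [← integral_id_chiSquareMeasure hT1, ← hU,
      integral_map hUmeas.aemeasurable (by fun_prop)]
  have hEV : ∫ ω, (V ω)⁻¹ ∂P = ((S : ℝ) * ((T : ℝ) - 1) - 2)⁻¹ := by
    rw [← integral_inv_chiSquareMeasure h, ← hV,
      integral_map hVmeas.aemeasurable measurable_inv.aestronglyMeasurable]
  have hind : IndepFun U (fun ω ↦ (V ω)⁻¹) P := hUV.comp measurable_id measurable_inv
  have hmean : (∫ ω, σ ^ 2 * (S : ℝ) * U ω / V ω ∂P) =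
      σ ^ 2 * ((S : ℝ) * ((T : ℝ) - 1)) / ((S : ℝ) * ((T : ℝ) - 1) - 2) := by
    simp_rw [mul_div_assoc, div_eq_mul_inv]
    rw [integral_const_mul, hind.integral_fun_mul_eq_mul_integral
      hUmeas.aestronglyMeasurable hVmeas.inv.aestronglyMeasurable, hEU, hEV]
    ring
  refine ⟨hmean, ?_⟩
  have hne : (S : ℝ) * ((T : ℝ) - 1) - 2 ≠ 0 := by linarith
  rw [hmean, eq_div_iff hne, sub_mul, div_mul_cancel₀ _ hne]
  ring
end

section
/- Let T ≥ 2 and S ≥ 1 be integers with S(T−1) > 4, and let σ > 0. Let U and V be independent random variables, with U distributed as χ²_{T−1} and V distributed as χ²_{S(T−1)}. Then the variance of σ² S U / V equals 2σ⁴ κ₁ / (T−1), where κ₁ := (S(T−1))² · ((T−1) + S(T−1) − 2) / ((S(T−1) − 2)² (S(T−1) − 4)). -/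
open MeasureTheory ProbabilityTheory Real

theorem measurable_chiSquare_density (d : ℝ) :
    Measurable fun x : ℝ => if 0 < x then x ^ (d / 2 - 1) * Real.exp (-x / 2) /
      (2 ^ (d / 2) * Real.Gamma (d / 2)) else 0 :=
  Measurable.ite measurableSet_Ioi (by fun_prop) measurable_const

theorem mul_toReal_chiSquare_density {d : ℝ} (hd : 0 < d) {s : ℝ} {f : ℝ → ℝ}
    (hf : ∀ x, 0 < x → f x = x ^ s) :
    (fun x => f x * (ENNReal.ofReal (if 0 < x then x ^ (d / 2 - 1) * Real.exp (-x / 2) /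
      (2 ^ (d / 2) * Real.Gamma (d / 2)) else 0)).toReal) =
    (Set.Ioi 0).indicator fun x : ℝ => (2 ^ (d / 2) * Real.Gamma (d / 2))⁻¹ *
      (x ^ (d / 2 + s - 1) * Real.exp (-(1 / 2 * x))) := by
  have hG := Real.Gamma_pos_of_pos (half_pos hd)
  ext x
  by_cases hx : 0 < x
  · have hpow : x ^ (d / 2 + s - 1) = x ^ s * x ^ (d / 2 - 1) := by
      rw [← Real.rpow_add hx]; congr 1; ring
    rw [Set.indicator_of_mem (Set.mem_Ioi.mpr hx), if_pos hx, ENNReal.toReal_ofReal (by positivity),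
      hf x hx, hpow, show -x / 2 = -(1 / 2 * x) by ring]
    ring
  · rw [Set.indicator_of_notMem (by simpa using hx), if_neg hx]
    simp

theorem integrable_chiSquareMeasure {d : ℝ} (hd : 0 < d) {s : ℝ} (hs : 0 < d / 2 + s)
    {f : ℝ → ℝ} (hf : ∀ x, 0 < x → f x = x ^ s) : Integrable f (chiSquareMeasure d) := by
  rw [chiSquareMeasure, integrable_withDensity_iff (measurable_chiSquare_density d).ennreal_ofReal
    (by simp), mul_toReal_chiSquare_density hd hf, integrable_indicator_iff measurableSet_Ioi]
  have h := integrableOn_rpow_mul_exp_neg_mul_rpow (p := 1) (s := d / 2 + s - 1) (b := 1 / 2)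
    (by linarith) one_pos (by norm_num)
  simp only [Real.rpow_one, neg_mul] at h
  exact h.const_mul _

theorem integral_chiSquareMeasure {d : ℝ} (hd : 0 < d) {s : ℝ} (hs : 0 < d / 2 + s)
    {f : ℝ → ℝ} (hf : ∀ x, 0 < x → f x = x ^ s) :
    ∫ x, f x ∂chiSquareMeasure d = 2 ^ s * Real.Gamma (d / 2 + s) / Real.Gamma (d / 2) := by
  rw [chiSquareMeasure, integral_withDensity_eq_integral_toReal_smul
    (measurable_chiSquare_density d).ennreal_ofReal (by simp)]
  simp only [smul_eq_mul, mul_comm _ (f _)]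
  rw [mul_toReal_chiSquare_density hd hf, integral_indicator measurableSet_Ioi,
    integral_const_mul, Real.integral_rpow_mul_exp_neg_mul_Ioi hs (by norm_num), one_div_one_div,
    Real.rpow_add two_pos]
  field_simp

theorem integral_sq_chiSquareMeasure {d : ℝ} (hd : 0 < d) :
    ∫ x, x ^ 2 ∂chiSquareMeasure d = d * (d + 2) := by
  have hG := (Real.Gamma_pos_of_pos (half_pos hd)).ne'
  rw [integral_chiSquareMeasure hd (s := 2) (by linarith) (by simp),
    show d / 2 + 2 = d / 2 + 1 + 1 by ring, Real.Gamma_add_one (by linarith),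
    Real.Gamma_add_one (by linarith), Real.rpow_two]
  field_simp

theorem integral_inv_sq_chiSquareMeasure {d : ℝ} (hd : 4 < d) :
    ∫ x, (x⁻¹) ^ 2 ∂chiSquareMeasure d = ((d - 2) * (d - 4))⁻¹ := by
  have hG := (Real.Gamma_pos_of_pos (show 0 < (d - 4) / 2 by linarith)).ne'
  have h2 : d - 2 ≠ 0 := by linarith
  have h4 : d - 4 ≠ 0 := by linarith
  have hrec : Real.Gamma (d / 2) = (d - 2) / 2 * ((d - 4) / 2 * Real.Gamma ((d - 4) / 2)) := by
    rw [← Real.Gamma_add_one (by positivity), show (d - 4) / 2 + 1 = (d - 2) / 2 by ring,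
      ← Real.Gamma_add_one (by positivity)]
    congr 1; ring
  rw [integral_chiSquareMeasure (by linarith) (s := -2) (by linarith)
    (fun x hx => by rw [Real.rpow_neg hx.le, Real.rpow_two, inv_pow]),
    show d / 2 + -2 = (d - 4) / 2 by ring, hrec, Real.rpow_neg zero_le_two, Real.rpow_two]
  field_simp

theorem variance_mul_of_indepFun {Ω : Type*} [MeasurableSpace Ω] {P : Measure Ω}
    [IsProbabilityMeasure P] {X Y : Ω → ℝ} (hX : MemLp X 2 P) (hY : MemLp Y 2 P)
    (hXY : IndepFun X Y P) :
    variance (fun ω => X ω * Y ω) P =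
      (∫ ω, X ω ^ 2 ∂P) * (∫ ω, Y ω ^ 2 ∂P) - ((∫ ω, X ω ∂P) * ∫ ω, Y ω ∂P) ^ 2 := by
  have hsq : IndepFun (fun ω => X ω ^ 2) (fun ω => Y ω ^ 2) P :=
    hXY.comp (φ := (· ^ 2)) (ψ := (· ^ 2)) (by fun_prop) (by fun_prop)
  have hmeas : AEStronglyMeasurable (fun ω => X ω * Y ω) P :=
    hX.aestronglyMeasurable.mul hY.aestronglyMeasurable
  have hL : MemLp (fun ω => X ω * Y ω) 2 P := by
    rw [memLp_two_iff_integrable_sq hmeas]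
    simp only [mul_pow]
    exact hsq.integrable_mul hX.integrable_sq hY.integrable_sq
  rw [variance_eq_sub hL]
  simp only [Pi.pow_apply, mul_pow]
  rw [hsq.integral_fun_mul_eq_mul_integral hX.integrable_sq.aestronglyMeasurable
    hY.integrable_sq.aestronglyMeasurable, hXY.integral_fun_mul_eq_mul_integral
    hX.aestronglyMeasurable hY.aestronglyMeasurable, mul_pow]

/-- In the Gaussian example, the SMD variance estimator `σ̂²_SMD = σ² S U / V`, with
independent `U ~ χ²_{T-1}` and `V ~ χ²_{S(T-1)}` and `S(T-1) > 4`, has variance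
`2 σ⁴ κ₁ / (T-1)` where
`κ₁ = (S(T-1))² ((T-1) + S(T-1) - 2) / ((S(T-1)-2)² (S(T-1)-4))`. -/
theorem smd_estimator_variance (T S : ℕ) (hT : 2 ≤ T) (hS : 1 ≤ S)
    (h : 4 < (S : ℝ) * ((T : ℝ) - 1)) (σ : ℝ) (hσ : 0 < σ)
    {Ω : Type*} [MeasurableSpace Ω] (P : Measure Ω) [IsProbabilityMeasure P]
    (U V : Ω → ℝ) (hUmeas : Measurable U) (hVmeas : Measurable V)
    (hUV : IndepFun U V P)
    (hU : Measure.map U P = chiSquareMeasure ((T : ℝ) - 1))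
    (hV : Measure.map V P = chiSquareMeasure ((S : ℝ) * ((T : ℝ) - 1))) :
    variance (fun ω => σ ^ 2 * (S : ℝ) * U ω / V ω) P =
      2 * σ ^ 4 *
          (((S : ℝ) * ((T : ℝ) - 1)) ^ 2 *
              (((T : ℝ) - 1) + (S : ℝ) * ((T : ℝ) - 1) - 2) /
            (((S : ℝ) * ((T : ℝ) - 1) - 2) ^ 2 * ((S : ℝ) * ((T : ℝ) - 1) - 4))) /
        ((T : ℝ) - 1) := by
  have hT' : (2 : ℝ) ≤ T := by exact_mod_cast hT
  have hp : 0 < (T : ℝ) - 1 := by linarith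
  set p : ℝ := (T : ℝ) - 1
  set q : ℝ := (S : ℝ) * p with hq
  have memLp_comp {W : Ω → ℝ} {d : ℝ} {g : ℝ → ℝ} (hW : Measurable W)
      (hmap : Measure.map W P = chiSquareMeasure d) (hg : Measurable g)
      (hint : Integrable (fun x => g x ^ 2) (chiSquareMeasure d)) :
      MemLp (fun ω => g (W ω)) 2 P := by
    refine (memLp_two_iff_integrable_sq (hg.comp hW).aestronglyMeasurable).mpr ?_
    rw [← hmap] at hint
    exact hint.comp_measurable hW
  have integral_comp {W : Ω → ℝ} {d : ℝ} {g : ℝ → ℝ} (hW : Measurable W)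
      (hmap : Measure.map W P = chiSquareMeasure d) (hg : Measurable g) :
      ∫ ω, g (W ω) ∂P = ∫ x, g x ∂chiSquareMeasure d := by
    rw [← hmap, integral_map hW.aemeasurable hg.aestronglyMeasurable]
  have hUL : MemLp U 2 P := memLp_comp (g := id) hUmeas hU measurable_id
    (integrable_chiSquareMeasure hp (s := 2) (by linarith) (by simp))
  have hVL : MemLp (fun ω => (V ω)⁻¹) 2 P := memLp_comp hVmeas hV measurable_inv
    (integrable_chiSquareMeasure (by linarith) (s := -2) (by linarith)
      (fun x hx => by rw [Real.rpow_neg hx.le, Real.rpow_two, inv_pow]))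
  have hind : IndepFun U (fun ω => (V ω)⁻¹) P := hUV.comp measurable_id measurable_inv
  have hfun : (fun ω => σ ^ 2 * (S : ℝ) * U ω / V ω) =
      fun ω => (σ ^ 2 * S) * (U ω * (V ω)⁻¹) := by
    ext ω; ring
  rw [hfun, variance_const_mul, variance_mul_of_indepFun hUL hVL hind,
    integral_comp (g := (· ^ 2)) hUmeas hU (by fun_prop),
    integral_comp (g := (·⁻¹ ^ 2)) hVmeas hV (by fun_prop),
    integral_comp (g := fun x => x) hUmeas hU (by fun_prop),
    integral_comp (g := (·⁻¹)) hVmeas hV (by fun_prop),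
    integral_id_chiSquareMeasure hp, integral_sq_chiSquareMeasure hp,
    integral_inv_chiSquareMeasure (by linarith), integral_inv_sq_chiSquareMeasure h]
  have h2 : q - 2 ≠ 0 := by linarith
  have h4 : q - 4 ≠ 0 := by linarith
  have hSq : (S : ℝ) = q / p := by rw [hq]; field_simp
  clear_value q
  rw [hSq]
  field_simp
  ring
end
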